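/- For any measure μ over a subset S of density matrices on a d-dimensional Hilbert space and any n, there exist N ≤ (n+1)^{2d²} states ρ₁,…,ρ_N ∈ S and a probability distribution (p₁,…,p_N) such that ∫ ρ^{⊗n} dμ(ρ) = ∑ᵢ pᵢ ρᵢ^{⊗n}. -/

import Mathlib

noncomputable section
open scoped BigOperators ComplexOrder
open MeasureTheory

variable {n : Type*} [Fintype n] [DecidableEq n]

/-- Measurable space structure on matrices (entrywise, via the pi structure). -/
instance matrixMeasurableSpace {m k : Type*} : MeasurableSpace (Matrix m k ℂ) :=
  inferInstanceAs (MeasurableSpace (m → k → ℂ))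

/-- A density matrix: positive semidefinite with trace one. -/
def IsDensity (ρ : Matrix n n ℂ) : Prop := ρ.PosSemidef ∧ ρ.trace = 1

/-- `k`-fold tensor (Kronecker) power of a matrix. -/
noncomputable def tpow {d : ℕ} (ρ : Matrix (Fin d) (Fin d) ℂ) (k : ℕ) :
    Matrix (Fin k → Fin d) (Fin k → Fin d) ℂ :=
  Matrix.of fun x y => ∏ i, ρ (x i) (y i)

/-- Weak separation of a point from a convex set in finite dimension. -/
lemma exists_weak_sep {E : Type*} [NormedAddCommGroup E] [NormedSpace ℝ E] [FiniteDimensional ℝ E]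
    {C : Set E} (hC : Convex ℝ C) (hne : C.Nonempty) (h0 : (0 : E) ∉ C) :
    ∃ g : E →ₗ[ℝ] ℝ, g ≠ 0 ∧ ∀ x ∈ C, 0 ≤ g x := by
  by_cases hint : (interior C).Nonempty
  · obtain ⟨g, hg⟩ := geometric_hahn_banach_open_point hC.interior isOpen_interior
      (fun h => h0 (interior_subset h))
    refine ⟨-(g : E →ₗ[ℝ] ℝ), ?_, ?_⟩
    · intro h
      obtain ⟨x, hx⟩ := hint
      have h1 := hg x hx
      have h2 := congrArg (fun l : E →ₗ[ℝ] ℝ => l x) h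
      simp at h1 h2
      linarith
    · intro x hx
      have hx' : x ∈ closure (interior C) := by
        rw [hC.closure_interior_eq_closure_of_nonempty_interior hint]
        exact subset_closure hx
      have hcl : closure (interior C) ⊆ {x | g x ≤ 0} :=
        closure_minimal (fun y hy => by simpa using (hg y hy).le)
          (isClosed_le g.continuous continuous_const)
      simpa using hcl hx'
  · rw [hC.interior_nonempty_iff_affineSpan_eq_top] at hint
    have hdir : vectorSpan ℝ C < ⊤ := by
      rw [lt_top_iff_ne_top]
      intro h
      exact hint ((AffineSubspace.affineSpan_eq_top_iff_vectorSpan_eq_top_of_nonempty ℝ E E hne).2 h)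
    obtain ⟨g, hg0, hg⟩ := Submodule.exists_le_ker_of_lt_top _ hdir
    obtain ⟨c, hc⟩ := hne
    have hconst : ∀ x ∈ C, g x = g c := by
      intro x hx
      have : g (x - c) = 0 := hg (vsub_mem_vectorSpan ℝ hx hc)
      rw [map_sub] at this
      linarith
    rcases le_total 0 (g c) with h | h
    · exact ⟨g, hg0, fun x hx => by rw [hconst x hx]; exact h⟩
    · refine ⟨-g, by simpa using hg0, fun x hx => ?_⟩
      rw [LinearMap.neg_apply, hconst x hx]
      linarith

/-- The mean of a probability measure on a finite-dimensional space concentrated on `S` lies in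
the (not closed) convex hull of `S`. -/
lemma integral_mem_convexHull {Ω E : Type*} [MeasurableSpace Ω] (μ : Measure Ω)
    [IsProbabilityMeasure μ] [NormedAddCommGroup E] [NormedSpace ℝ E] [FiniteDimensional ℝ E]
    (f : Ω → E) (hf : Integrable f μ) (S : Set E) (hS : ∀ᵐ ω ∂μ, f ω ∈ S) :
    ∫ ω, f ω ∂μ ∈ convexHull ℝ S := by
  by_contra hm
  set m := ∫ ω, f ω ∂μ with hmdef
  have key : ∀ n : ℕ, ∀ W : Submodule ℝ E, Module.finrank ℝ W = n →
      (∀ᵐ ω ∂μ, f ω - m ∈ W) → False := by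
    intro n
    induction n using Nat.strong_induction_on with
    | _ n ih =>
      intro W hW hfW
      have hC : Convex ℝ {w : W | (w : E) + m ∈ convexHull ℝ S} := by
        have h1 := (convex_convexHull ℝ S).translate_preimage_left m
        exact h1.linear_preimage W.subtype
      obtain ⟨ω₀, h₀, h₀'⟩ := (hS.and hfW).exists
      obtain ⟨g, hg0, hg⟩ := exists_weak_sep hC
        ⟨⟨f ω₀ - m, h₀'⟩, by simpa using subset_convexHull ℝ S h₀⟩ (by simpa using hm)
      obtain ⟨G, hG⟩ := LinearMap.exists_extend g
      have hGg : ∀ w : W, G w = g w := fun w => by rw [← hG]; rfl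
      have hGi : Integrable (fun ω => G (f ω - m)) μ :=
        (LinearMap.toContinuousLinearMap G).integrable_comp (hf.sub (integrable_const m))
      have hG0 : ∫ ω, G (f ω - m) ∂μ = 0 := by
        have h1 := (LinearMap.toContinuousLinearMap G).integral_comp_comm
          (hf.sub (integrable_const m))
        have h2 : ∫ ω, (f ω - m) ∂μ = 0 := by
          rw [integral_sub hf (integrable_const m)]
          simp [← hmdef]
        exact h1.trans ((congrArg _ h2).trans (map_zero _))
      have hGn : 0 ≤ᵐ[μ] fun ω => G (f ω - m) := by
        filter_upwards [hS, hfW] with ω h1 h2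
        have := hg ⟨f ω - m, h2⟩ (by simpa using subset_convexHull ℝ S h1)
        rw [← hGg] at this
        exact this
      have hGz := (integral_eq_zero_iff_of_nonneg_ae hGn hGi).1 hG0
      have hlt : W ⊓ LinearMap.ker G < W := by
        refine lt_of_le_of_ne inf_le_left fun h => hg0 ?_
        ext w
        have : (w : E) ∈ W ⊓ LinearMap.ker G := by rw [h]; exact w.2
        rw [← hGg]
        exact this.2
      refine ih _ (hW ▸ Submodule.finrank_lt_finrank_of_lt hlt) _ rfl ?_
      filter_upwards [hfW, hGz] with ω h1 h2
      exact ⟨h1, h2⟩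
  exact key _ ⊤ rfl (by simp)

/-- Entries of a density matrix are bounded by one. -/
lemma IsDensity.norm_entry_le {d : ℕ} {ρ : Matrix (Fin d) (Fin d) ℂ} (h : IsDensity ρ)
    (i j : Fin d) : ‖ρ i j‖ ≤ 1 := by
  obtain ⟨hp, ht⟩ := h
  have hdiag : ∀ a, 0 ≤ ρ a a := fun a => hp.diag_nonneg
  have hdiag1 : ∀ a, (ρ a a).re ≤ 1 := by
    intro a
    have h1 : ρ a a ≤ ∑ b, ρ b b :=
      Finset.single_le_sum (f := fun b => ρ b b) (fun b _ => hdiag b) (Finset.mem_univ a)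
    have h2 : ∑ b, ρ b b = 1 := ht
    rw [h2] at h1
    simpa using (Complex.le_def.1 h1).1
  have hdet := (hp.submatrix ![i, j]).det_nonneg
  have hH : ρ j i = star (ρ i j) := (hp.1.apply j i).symm
  rw [Matrix.det_fin_two] at hdet
  simp only [Matrix.submatrix_apply, Matrix.cons_val_zero, Matrix.cons_val_one, hH] at hdet
  have h3 := (Complex.le_def.1 hdet).1
  have hi := (Complex.le_def.1 (hdiag i))
  have hj := (Complex.le_def.1 (hdiag j))
  have hi1 := hdiag1 i
  have hj1 := hdiag1 j
  have hn : ‖ρ i j‖ ^ 2 = (ρ i j).re ^ 2 + (ρ i j).im ^ 2 := by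
    rw [Complex.sq_norm, Complex.normSq_apply]; ring
  simp at h3 hi hj
  rw [← hi.2, ← hj.2] at h3
  have : ‖ρ i j‖ ^ 2 ≤ 1 := by
    rw [hn]; nlinarith
  nlinarith [norm_nonneg (ρ i j)]

/-- All monomials in the entries with exponents at most `k`. -/
def monoVec {d : ℕ} (k : ℕ) (ρ : Matrix (Fin d) (Fin d) ℂ) :
    (Fin d × Fin d → Fin (k + 1)) → ℂ :=
  fun a => ∏ q : Fin d × Fin d, ρ q.1 q.2 ^ (a q : ℕ)

/-- The type (exponent vector) of a pair of multi-indices. -/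
def typeOf {d k : ℕ} (x y : Fin k → Fin d) : Fin d × Fin d → Fin (k + 1) :=
  fun q => ⟨(Finset.univ.filter fun l => (x l, y l) = q).card,
    Nat.lt_succ_of_le ((Finset.card_le_univ _).trans (by simp))⟩

lemma tpow_eq_monoVec {d k : ℕ} (ρ : Matrix (Fin d) (Fin d) ℂ) (x y : Fin k → Fin d) :
    tpow ρ k x y = monoVec k ρ (typeOf x y) := by
  simp only [tpow, monoVec, typeOf, Matrix.of_apply]
  rw [← Finset.prod_fiberwise Finset.univ (fun l => (x l, y l)) (fun l => ρ (x l) (y l))]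
  refine Finset.prod_congr rfl fun q _ => ?_
  rw [← Finset.prod_const]
  refine Finset.prod_congr rfl fun l hl => ?_
  rw [← (Finset.mem_filter.1 hl).2]

lemma measurable_monoVec {d : ℕ} (k : ℕ) : Measurable (monoVec (d := d) k) := by
  refine measurable_pi_lambda _ fun a => ?_
  refine Finset.measurable_fun_prod _ fun q _ => ?_
  refine Measurable.pow_const ?_ _
  exact (measurable_pi_apply q.2).comp (measurable_pi_apply (X := fun _ => Fin d → ℂ) q.1)

lemma norm_monoVec_le {d k : ℕ} {ρ : Matrix (Fin d) (Fin d) ℂ} (h : IsDensity ρ) :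
    ‖monoVec k ρ‖ ≤ 1 := by
  rw [pi_norm_le_iff_of_nonneg zero_le_one]
  intro a
  rw [monoVec, norm_prod]
  refine Finset.prod_le_one (fun _ _ => norm_nonneg _) fun q _ => ?_
  rw [norm_pow]
  exact pow_le_one₀ (norm_nonneg _) (h.norm_entry_le _ _)

/-- Carathéodory-type discretization: every mixture `∫ ρ^{⊗k} dμ(ρ)` over a set `S` of
density matrices equals a finite convex combination `∑ᵢ pᵢ ρᵢ^{⊗k}` of at most
`(k+1)^(2d²)` tensor powers of states from `S`. -/
theorem caratheodory_iid_mixture {d k : ℕ}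
    (S : Set (Matrix (Fin d) (Fin d) ℂ)) (hS : ∀ ρ ∈ S, IsDensity ρ)
    (μ : Measure (Matrix (Fin d) (Fin d) ℂ)) [IsProbabilityMeasure μ] (hμS : μ Sᶜ = 0) :
    ∃ (N : ℕ), N ≤ (k + 1) ^ (2 * d ^ 2) ∧
      ∃ (p : Fin N → ℝ) (ρs : Fin N → Matrix (Fin d) (Fin d) ℂ),
        (∀ i, ρs i ∈ S) ∧ (∀ i, 0 ≤ p i) ∧ ∑ i, p i = 1 ∧
          ∀ x y, (∫ ρ, tpow ρ k x y ∂μ) = ∑ i, (p i : ℂ) * tpow (ρs i) k x y := by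
  have hae : ∀ᵐ ρ ∂μ, ρ ∈ S := by rwa [ae_iff]
  by_cases htriv : k = 0 ∨ d ≤ 1
  · obtain ⟨ρ₀, h₀⟩ := hae.exists
    refine ⟨1, Nat.one_le_pow _ _ (Nat.succ_pos k), fun _ => 1, fun _ => ρ₀, fun _ => h₀,
      fun _ => zero_le_one, by simp, fun x y => ?_⟩
    have hc : ∀ ρ ∈ S, tpow ρ k x y = tpow ρ₀ k x y := by
      intro ρ hρ
      rcases htriv with rfl | hd
      · simp [tpow]
      · have hsub : Subsingleton (Fin d) := by
          rw [Fin.subsingleton_iff_le_one]; exact hd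
        have hent : ∀ σ ∈ S, ∀ i j, σ i j = 1 := by
          intro σ hσ i j
          have ht := (hS σ hσ).2
          rw [Matrix.trace, Fintype.sum_subsingleton _ i, Matrix.diag_apply] at ht
          rw [Subsingleton.elim j i]
          exact ht
        simp [tpow, hent ρ hρ, hent ρ₀ h₀]
    rw [integral_congr_ae (g := fun _ => tpow ρ₀ k x y) (hae.mono fun ρ hρ => hc ρ hρ)]
    simp
  · push Not at htriv
    obtain ⟨hk, hd⟩ := htriv
    have hint : Integrable (monoVec (d := d) k) μ :=
      Integrable.of_bound (measurable_monoVec k).aestronglyMeasurable 1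
        (hae.mono fun ρ hρ => norm_monoVec_le (hS ρ hρ))
    have hmem := integral_mem_convexHull μ (monoVec (d := d) k) hint (monoVec k '' S)
      (hae.mono fun ρ hρ => ⟨ρ, hρ, rfl⟩)
    obtain ⟨ι, hι, z, w, hz, hind, hw, hw1, hsum⟩ := eq_pos_convex_span_of_mem_convexHull hmem
    have hcard : Fintype.card ι ≤ (k + 1) ^ (2 * d ^ 2) := by
      have h1 := hind.card_le_finrank_succ
      have h2 := Submodule.finrank_le (vectorSpan ℝ (Set.range z))
      have h3 : Module.finrank ℝ ((Fin d × Fin d → Fin (k + 1)) → ℂ)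
          = (k + 1) ^ (d ^ 2) * 2 := by
        rw [Module.finrank_pi_fintype]
        simp [Complex.finrank_real_complex, pow_two]
      have h4 : 4 ≤ (k + 1) ^ (d ^ 2) := by
        calc 4 = 2 ^ 2 := rfl
          _ ≤ 2 ^ (d ^ 2) := Nat.pow_le_pow_right (by norm_num) (by nlinarith)
          _ ≤ (k + 1) ^ (d ^ 2) := Nat.pow_le_pow_left (by omega) _
      have h5 : (k + 1) ^ (2 * d ^ 2) = (k + 1) ^ (d ^ 2) * (k + 1) ^ (d ^ 2) := by
        rw [two_mul, pow_add]
      rw [h5]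
      nlinarith
    choose ρ hρS hρ using fun i => hz (Set.mem_range_self i)
    let e := (Fintype.equivFin ι).symm
    refine ⟨Fintype.card ι, hcard, fun i => w (e i), fun i => ρ (e i), fun i => hρS _,
      fun i => (hw _).le, ?_, fun x y => ?_⟩
    · rw [e.sum_comp w, hw1]
    · simp only [tpow_eq_monoVec]
      rw [e.sum_comp (fun i => (w i : ℂ) * monoVec k (ρ i) (typeOf x y))]
      have h1 := congrFun hsum (typeOf x y)
      rw [eval_integral (fun a => (hint.eval a))] at h1
      rw [← h1]
      simp [hρ]
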